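/- Let D, n, p be positive integers, C : Fin D → Fin D → Matrix (Fin n) (Fin n) ℂ and B : Fin D → Fin D → Matrix (Fin p) (Fin p) ℂ families of matrices, and c ∈ ℂ with c ≠ 0. Assume: (i) for every L ≥ 1 and all i, j : Fin L → Fin D, trace(C^(i₁j₁)⋯C^(i_Lj_L)) = c^L · trace(B^(i₁j₁)⋯B^(i_Lj_L)); (ii) for every L ≥ 1 the matrix U_L, indexed by pairs of tuples in (Fin L → Fin D) and with entries (U_L)_{i,j} = trace(B^(i₁j₁)⋯B^(i_Lj_L)), is unitary, i.e. U_L · U_Lᴴ = 1. Then the ℂ-linear endomorphism f of Matrix (Fin n) (Fin p) ℂ defined by f(M) = (c·D)⁻¹ • ∑_{i,j ∈ Fin D} C^(ij) · M · (B^(ij))ᴴ has characteristic polynomial X^(np−1)·(X − 1), and likewise the ℂ-linear endomorphism g of Matrix (Fin p) (Fin n) ℂ defined by g(M) = (c·D)⁻¹ • ∑_{i,j ∈ Fin D} (B^(ij))ᴴ · M · C^(ij) has characteristic polynomial X^(np−1)·(X − 1). In particular both maps have 1 as an eigenvalue of algebraic multiplicity one and all their other eigenvalues are 0. -/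

import Mathlib

open Polynomial Matrix

open scoped Kronecker

theorem Matrix.det_aeval_eq_prod_roots_charpoly {m K : Type*} [Fintype m] [DecidableEq m]
    [Field K] [IsAlgClosed K] (A : Matrix m m K) (q : K[X]) :
    (aeval A q).det = (A.charpoly.roots.map fun r => q.eval r).prod := by
  have hcard : A.charpoly.roots.card = Fintype.card m := by
    rw [← (IsAlgClosed.splits A.charpoly).natDegree_eq_card_roots, charpoly_natDegree_eq_dim]
  have hlin (b : K) : (aeval A (X - C b)).det
      = (A.charpoly.roots.map fun r => (X - C b).eval r).prod := by
    have h1 : aeval A (X - C b) = -(scalar m b - A) := by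
      simp [algebraMap_eq_diagonal, scalar_apply, Pi.algebraMap_def]
    have h2 : A.charpoly.eval b = (A.charpoly.roots.map fun r => b - r).prod := by
      conv_lhs => rw [(IsAlgClosed.splits A.charpoly).eq_prod_roots_of_monic A.charpoly_monic]
      simp [eval_multiset_prod]
    rw [h1, det_neg, ← eval_charpoly, h2, ← hcard, ← Multiset.card_map (fun r => b - r),
      ← Multiset.prod_map_neg]
    simp
  rw [(IsAlgClosed.splits q).eq_prod_roots]
  generalize q.roots = t
  induction t using Multiset.induction_on with
  | empty => simp [hcard, algebraMap_eq_diagonal, Pi.algebraMap_def]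
  | cons b t ih =>
    rw [Multiset.map_cons, Multiset.prod_cons, mul_left_comm, map_mul, det_mul, ih, hlin,
      ← Multiset.prod_map_mul]
    simp

theorem Matrix.trace_pow_eq_sum_roots_charpoly {m K : Type*} [Fintype m] [DecidableEq m]
    [Field K] [IsAlgClosed K] (A : Matrix m m K) (k : ℕ) :
    (A ^ k).trace = (A.charpoly.roots.map fun r => r ^ k).sum := by
  have hcp : (A ^ k).charpoly
      = ((A.charpoly.roots.map fun r => r ^ k).map fun r => X - C r).prod := by
    have : Infinite K := IsAlgClosed.instInfinite
    refine Polynomial.funext fun x => ?_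
    have h := A.det_aeval_eq_prod_roots_charpoly (C x - X ^ k)
    rw [eval_charpoly, eval_multiset_prod, Multiset.map_map, Multiset.map_map]
    simpa [algebraMap_eq_diagonal, scalar_apply, Pi.algebraMap_def] using h
  rw [trace_eq_sum_roots_charpoly, hcp, roots_multiset_prod_X_sub_C]

theorem Multiset.eq_replicate_zero_add_one_of_sum_pow {K : Type*} [Field K] [CharZero K]
    (s : Multiset K) (h : ∀ k : ℕ, 1 ≤ k → (s.map fun r => r ^ k).sum = 1) :
    s = replicate (s.card - 1) 0 + {1} := by
  classical
  have hX (r : K[X]) : (s.map fun a => (X * r).eval a).sum = (X * r).eval 1 := by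
    induction r using Polynomial.induction_on' with
    | add p q hp hq =>
      simp only [mul_add, eval_add, Multiset.sum_map_add] at hp hq ⊢
      rw [hp, hq]
    | monomial k b =>
      have := h (k + 1) (by omega)
      simp only [eval_mul, eval_X, eval_monomial, one_pow, mul_one, one_mul]
      calc (s.map fun a => a * (b * a ^ k)).sum = (s.map fun a => b * a ^ (k + 1)).sum := by
            congr 1; refine Multiset.map_congr rfl fun a _ => by ring
        _ = b := by rw [Multiset.sum_map_mul_left, this, mul_one]
  have hcount (μ : K) (hμ : μ ≠ 0) : s.count μ = if μ = 1 then 1 else 0 := by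
    set r : K[X] := ∏ b ∈ (insert 1 s.toFinset).erase μ, (X - C b) with hr
    have hne : (X * r).eval μ ≠ 0 := by
      rw [eval_mul, eval_X, hr, eval_prod]
      refine mul_ne_zero hμ (Finset.prod_ne_zero_iff.2 fun b hb => ?_)
      rw [eval_sub, eval_X, eval_C, sub_ne_zero]
      exact (Finset.ne_of_mem_erase hb).symm
    have hz (a : K) (ha : a ∈ insert 1 s.toFinset) (hne : a ≠ μ) : (X * r).eval a = 0 := by
      rw [eval_mul, hr, eval_prod,
        Finset.prod_eq_zero (Finset.mem_erase.2 ⟨hne, ha⟩) (by simp), mul_zero]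
    have hsum : (s.map fun a => (X * r).eval a).sum = (s.count μ : K) * (X * r).eval μ := by
      rw [Multiset.sum_map_eq_nsmul_single μ, nsmul_eq_mul]
      intro a hne ha
      exact hz a (by simp [ha]) hne
    rw [hX] at hsum
    split_ifs with h1
    · subst h1
      have := mul_right_cancel₀ hne ((one_mul _).trans hsum)
      exact_mod_cast this.symm
    · rw [hz 1 (by simp) (Ne.symm h1)] at hsum
      exact_mod_cast (mul_eq_zero.1 hsum.symm).resolve_right hne
  have hs : s = replicate (s.count 0) 0 + {1} := by
    ext μ
    rw [count_add, count_replicate, count_singleton]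
    by_cases hμ : μ = 0
    · simp [hμ]
    · rw [hcount μ hμ, if_neg (Ne.symm hμ), zero_add]
  have hcard : s.card = s.count 0 + 1 := by
    conv_lhs => rw [hs]
    simp
  rw [hcard, Nat.add_sub_cancel]
  exact hs

theorem Matrix.charpoly_eq_of_trace_pow_eq_one {m K : Type*} [Fintype m] [DecidableEq m]
    [Field K] [CharZero K] [IsAlgClosed K] (A : Matrix m m K)
    (h : ∀ k : ℕ, 1 ≤ k → (A ^ k).trace = 1) :
    A.charpoly = X ^ (Fintype.card m - 1) * (X - 1) := by
  have hs := A.charpoly.roots.eq_replicate_zero_add_one_of_sum_pow fun k hk => by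
    rw [← trace_pow_eq_sum_roots_charpoly, h k hk]
  rw [(IsAlgClosed.splits A.charpoly).eq_prod_roots_of_monic A.charpoly_monic, hs,
    ← (IsAlgClosed.splits A.charpoly).natDegree_eq_card_roots, charpoly_natDegree_eq_dim]
  simp

theorem Fintype.sum_pow_eq_sum_prod_ofFn {ι R : Type*} [Fintype ι] [Semiring R] (A : ι → R)
    (L : ℕ) : (∑ x, A x) ^ L = ∑ w : Fin L → ι, (List.ofFn fun l => A (w l)).prod := by
  induction L with
  | zero => simp
  | succ L ih =>
    rw [pow_succ', ih, Finset.sum_mul_sum, ← Fintype.sum_prod_type',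
      ← (Fin.consEquiv fun _ : Fin (L + 1) => ι).sum_comp]
    simp [Fin.consEquiv, List.ofFn_succ]

theorem Matrix.prod_ofFn_kronecker {m k R : Type*} [Fintype m] [DecidableEq m] [Fintype k]
    [DecidableEq k] [CommSemiring R] (L : ℕ) (A : Fin L → Matrix m m R)
    (B : Fin L → Matrix k k R) :
    (List.ofFn fun l => A l ⊗ₖ B l).prod = (List.ofFn A).prod ⊗ₖ (List.ofFn B).prod := by
  induction L with
  | zero => simp
  | succ L ih => simp [List.ofFn_succ, ih, mul_kronecker_mul]

theorem Matrix.trace_sum_kronecker_conj_pow {m k ι : Type*} [Fintype m] [DecidableEq m]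
    [Fintype k] [DecidableEq k] [Fintype ι] (C : ι → Matrix m m ℂ) (B : ι → Matrix k k ℂ)
    (L : ℕ) :
    ((∑ x, C x ⊗ₖ (B x).map (starRingEnd ℂ)) ^ L).trace
      = ∑ w : Fin L → ι, (List.ofFn fun l => C (w l)).prod.trace
          * star (List.ofFn fun l => B (w l)).prod.trace := by
  rw [Fintype.sum_pow_eq_sum_prod_ofFn, trace_sum]
  refine Finset.sum_congr rfl fun w _ => ?_
  rw [prod_ofFn_kronecker L (fun l => C (w l)) fun l => (B (w l)).map (starRingEnd ℂ),
    trace_kronecker]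
  congr 1
  have h : (List.ofFn fun l => (B (w l)).map (starRingEnd ℂ)).prod
      = (starRingEnd ℂ).mapMatrix (List.ofFn fun l => B (w l)).prod := by
    rw [map_list_prod, List.map_ofFn]
    rfl
  rw [h]
  simp [trace]

/-- Proposition 2 of the paper: if the MPO generated by `C` equals `c^L` times the MPO
generated by the MPU tensor `B` for every length `L ≥ 1`, and all the MPOs generated by `B`
are unitary, then the right and left `(k-1,1)`-transfer matrices
`M ↦ (cD)⁻¹ • ∑ C^(ij) M (B^(ij))ᴴ` and `M ↦ (cD)⁻¹ • ∑ (B^(ij))ᴴ M C^(ij)` have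
characteristic polynomial `X^(np-1)·(X-1)`. -/
theorem stmt_3 (D n p : ℕ) (hD : 0 < D) (hn : 0 < n) (hp : 0 < p)
    (C : Fin D → Fin D → Matrix (Fin n) (Fin n) ℂ)
    (B : Fin D → Fin D → Matrix (Fin p) (Fin p) ℂ)
    (c : ℂ) (hc : c ≠ 0)
    (h1 : ∀ L : ℕ, 1 ≤ L → ∀ i j : Fin L → Fin D,
      ((List.ofFn fun l : Fin L => C (i l) (j l)).prod).trace
        = c ^ L * ((List.ofFn fun l : Fin L => B (i l) (j l)).prod).trace)
    (h2 : ∀ L : ℕ, 1 ≤ L →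
      (Matrix.of fun i j : Fin L → Fin D =>
          ((List.ofFn fun l : Fin L => B (i l) (j l)).prod).trace)
        * (Matrix.of fun i j : Fin L → Fin D =>
          ((List.ofFn fun l : Fin L => B (i l) (j l)).prod).trace)ᴴ = 1)
    (f : Matrix (Fin n) (Fin p) ℂ →ₗ[ℂ] Matrix (Fin n) (Fin p) ℂ)
    (hf : ∀ M : Matrix (Fin n) (Fin p) ℂ,
      f M = (c * (D : ℂ))⁻¹ • ∑ i : Fin D, ∑ j : Fin D, C i j * M * (B i j)ᴴ)
    (g : Matrix (Fin p) (Fin n) ℂ →ₗ[ℂ] Matrix (Fin p) (Fin n) ℂ)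
    (hg : ∀ M : Matrix (Fin p) (Fin n) ℂ,
      g M = (c * (D : ℂ))⁻¹ • ∑ i : Fin D, ∑ j : Fin D, (B i j)ᴴ * M * C i j) :
    LinearMap.charpoly f = X ^ (n * p - 1) * (X - 1) ∧
    LinearMap.charpoly g = X ^ (n * p - 1) * (X - 1) := by
  have hcD : c * (D : ℂ) ≠ 0 := mul_ne_zero hc (Nat.cast_ne_zero.2 hD.ne')
  set F : Matrix (Fin n × Fin p) (Fin n × Fin p) ℂ :=
    (c * (D : ℂ))⁻¹ • ∑ x : Fin D × Fin D, C x.1 x.2 ⊗ₖ (B x.1 x.2).map (starRingEnd ℂ) with hF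
  have htr (L : ℕ) (hL : 1 ≤ L) : (F ^ L).trace = 1 := by
    have hU := congrArg trace (h2 L hL)
    simp only [trace, diag_apply, mul_apply, conjTranspose_apply, of_apply, one_apply_eq,
      Finset.sum_const, Finset.card_univ, Fintype.card_pi, Fintype.card_fin, Finset.prod_const,
      nsmul_eq_mul, mul_one, Nat.cast_pow] at hU
    rw [hF, _root_.smul_pow, trace_smul,
      trace_sum_kronecker_conj_pow (fun x : Fin D × Fin D => C x.1 x.2) fun x => B x.1 x.2]
    simp only [h1 L hL (fun l => _) fun l => _, mul_assoc]
    rw [← Finset.mul_sum,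
      ← (Equiv.arrowProdEquivProdArrow (Fin L) (fun _ => Fin D) fun _ => Fin D).symm.sum_comp,
      Fintype.sum_prod_type]
    simp only [Equiv.arrowProdEquivProdArrow, Equiv.coe_fn_symm_mk, trace, diag_apply]
    rw [hU, smul_eq_mul, ← mul_pow, inv_pow, inv_mul_cancel₀ (pow_ne_zero _ hcD)]
  have hFc : F.charpoly = X ^ (n * p - 1) * (X - 1) := by
    simpa using F.charpoly_eq_of_trace_pow_eq_one htr
  have hfF : LinearMap.toMatrix (stdBasis ℂ (Fin n) (Fin p)) (stdBasis ℂ (Fin n) (Fin p)) f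
      = F := by
    ext ⟨a, b⟩ ⟨a', b'⟩
    rw [LinearMap.toMatrix_apply, stdBasis_eq_single, hf, hF]
    change ((c * (D : ℂ))⁻¹ • ∑ i : Fin D, ∑ j : Fin D,
      C i j * single a' b' (1 : ℂ) * (B i j)ᴴ : Matrix (Fin n) (Fin p) ℂ) a b = _
    simp [Matrix.sum_apply, Fintype.sum_prod_type, mul_apply, single_apply, ite_and]
  have hgF : LinearMap.toMatrix (stdBasis ℂ (Fin p) (Fin n)) (stdBasis ℂ (Fin p) (Fin n)) g
      = reindex (Equiv.prodComm _ _) (Equiv.prodComm _ _) Fᵀ := by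
    ext ⟨a, b⟩ ⟨a', b'⟩
    rw [LinearMap.toMatrix_apply, stdBasis_eq_single, hg, hF]
    change ((c * (D : ℂ))⁻¹ • ∑ i : Fin D, ∑ j : Fin D,
      (B i j)ᴴ * single a' b' (1 : ℂ) * C i j : Matrix (Fin p) (Fin n) ℂ) a b = _
    simp [Matrix.sum_apply, Fintype.sum_prod_type, mul_apply, single_apply, ite_and, mul_comm]
  constructor
  · rw [← LinearMap.charpoly_toMatrix f (stdBasis ℂ (Fin n) (Fin p)), hfF, hFc]
  · rw [← LinearMap.charpoly_toMatrix g (stdBasis ℂ (Fin p) (Fin n)), hgF, charpoly_reindex,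
      charpoly_transpose, hFc]
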